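/- (Kernel representation of the quadratic variation.) Let N ≥ 1 and M : ℤ → ℝ satisfy (M1) and (M2), and let K̂_M be the associated kernel. For every finitely supported α : ℤ → ℝ, define α̂(k') = ∑_{n∈ℤ} α_n e^{−2πik'n} and, for each n ∈ ℤ and k ∈ ℝ, c_n(k) = ∑_{1≤|d|≤N} M(d)(α_n − α_{n+d}) e^{−2πik(n−d)} + (∑_{1≤|d|≤N} M(d) α_{n+d}) e^{−2πikn}. Then for every k ∈ ℝ: (1/2) ∑_{n∈ℤ} |c_n(k)|² = ∫_{−1/2}^{1/2} K̂_M(k,k') |α̂(k')|² dk'. -/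

import Mathlib

open Finset Real

noncomputable def Sig (N : ℕ) (M : ℤ → ℝ) (d : ℤ) : ℝ :=
  ∑ d₁ ∈ Finset.Icc (-(N:ℤ)) N, ∑ d₂ ∈ Finset.Icc (-(N:ℤ)) N,
    if d₁ + d₂ = d ∧ d₁ ≠ 0 ∧ d₂ ≠ 0 then M d₁ * M d₂ else 0

/-- The kernel coefficients `K_M(d,d')`. -/
noncomputable def Kcoef (N : ℕ) (M : ℤ → ℝ) (d d' : ℤ) : ℝ :=
  if d = 0 ∧ d' = 0 then 3 * ∑ j ∈ Finset.Icc (1:ℤ) N, M j ^ 2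
  else if 1 ≤ |d| ∧ |d| ≤ (N:ℤ) ∧ d' = 0 then -(M d ^ 2) - (1/2) * Sig N M d
  else if 1 ≤ |d'| ∧ |d'| ≤ (N:ℤ) ∧ d = 0 then -(M d' ^ 2) - (1/2) * Sig N M d'
  else if (N:ℤ) + 1 ≤ |d| ∧ |d| ≤ 2*(N:ℤ) ∧ d' = 0 then -(1/2) * Sig N M d
  else if (N:ℤ) + 1 ≤ |d'| ∧ |d'| ≤ 2*(N:ℤ) ∧ d = 0 then -(1/2) * Sig N M d'
  else if (d' = d ∨ d' = -d) ∧ 1 ≤ |d| ∧ |d| ≤ 2*(N:ℤ) then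
    if 2*|d| ≤ (N:ℤ) then -(1/4) * Sig N M d - M d * M (2*d)
    else -(1/4) * Sig N M d
  else if 1 ≤ |d| ∧ |d| ≤ (N:ℤ) ∧ (N:ℤ) < |d'| ∧ |d'| ≤ 2*(N:ℤ) then
    if |d' - d| ≤ (N:ℤ) then (1/2) * (M d * M (d' - d))
    else if |d' + d| ≤ (N:ℤ) then -(1/2) * (M d * M (d' + d))
    else 0
  else if 1 ≤ |d'| ∧ |d'| ≤ (N:ℤ) ∧ (N:ℤ) < |d| ∧ |d| ≤ 2*(N:ℤ) then
    if |d - d'| ≤ (N:ℤ) then (1/2) * (M d' * M (d - d'))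
    else if |d + d'| ≤ (N:ℤ) then -(1/2) * (M d' * M (d + d'))
    else 0
  else if 1 ≤ |d| ∧ |d| ≤ (N:ℤ) ∧ 1 ≤ |d'| ∧ |d'| ≤ (N:ℤ) then
    if |d - d'| ≤ (N:ℤ) ∧ |d + d'| ≤ (N:ℤ) then
      (1/2) * (M d' * M (d - d') + M d * M (d' - d)
        - M d' * M (d + d') - M d * M (d + d'))
    else if |d - d'| ≤ (N:ℤ) ∧ (N:ℤ) < |d + d'| then
      (1/2) * (M d' * M (d - d') + M d * M (d' - d))
    else if |d + d'| ≤ (N:ℤ) ∧ (N:ℤ) < |d - d'| then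
      -(1/2) * (M d' * M (d + d') + M d * M (d + d'))
    else 0
  else 0

/-- The controlled kernel `K̂_M(k,k')`. -/
noncomputable def Khat (N : ℕ) (M : ℤ → ℝ) (k k' : ℝ) : ℝ :=
  ∑ d ∈ Finset.Icc (-(2*(N:ℤ))) (2*(N:ℤ)), ∑ d' ∈ Finset.Icc (-(2*(N:ℤ))) (2*(N:ℤ)),
    Kcoef N M d d' * Real.cos (2*π*d*k) * Real.cos (2*π*d'*k')

/-- The Fourier transform `α̂(k') = ∑_{n∈ℤ} α_n e^{−2πik'n}` of a configuration `α`. -/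
noncomputable def alphaHat (α : ℤ → ℝ) (k' : ℝ) : ℂ :=
  ∑' n : ℤ, (α n : ℂ) * Complex.exp (-(2*(π:ℂ)*Complex.I) * k' * n)

/-- `c_n(k) = ∑_{1≤|d|≤N} M(d)(α_n − α_{n+d}) e^{−2πik(n−d)}
  + (∑_{1≤|d|≤N} M(d) α_{n+d}) e^{−2πikn}`,
the action of the controlled vector field `λ_n^M` on the Fourier wave function. -/
noncomputable def cFun (N : ℕ) (M : ℤ → ℝ) (α : ℤ → ℝ) (k : ℝ) (n : ℤ) : ℂ :=
  (∑ d ∈ (Finset.Icc (-(N:ℤ)) (N:ℤ)).erase 0,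
      ((M d * (α n - α (n+d)) : ℝ) : ℂ) *
        Complex.exp (-(2*(π:ℂ)*Complex.I) * k * ((n:ℂ) - (d:ℂ))))
  + ((∑ d ∈ (Finset.Icc (-(N:ℤ)) (N:ℤ)).erase 0, M d * α (n+d) : ℝ) : ℂ) *
      Complex.exp (-(2*(π:ℂ)*Complex.I) * k * (n:ℂ))

/-- `s(x) = ∑ M(d) sin(2πdx)`. -/
noncomputable def sFun (N : ℕ) (M : ℤ → ℝ) (x : ℝ) : ℝ :=
  ∑ d ∈ Finset.Icc (-(N:ℤ)) N, M d * Real.sin (2*π*d*x)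

/-- `Q(x,y) = ∑ M(d) sin(2πdx) cos(2πdy)`. -/
noncomputable def qFun (N : ℕ) (M : ℤ → ℝ) (x y : ℝ) : ℝ :=
  ∑ d ∈ Finset.Icc (-(N:ℤ)) N, M d * Real.sin (2*π*d*x) * Real.cos (2*π*d*y)

/-- the symmetrised coefficient -/
noncomputable def Tcoef (N : ℕ) (M : ℤ → ℝ) (d d' : ℤ) : ℝ :=
  (if d' = 0 then -(1/2) * Sig N M d else 0) + (if d = 0 then -(1/2) * Sig N M d' else 0)
  + (if d' = d then -(1/4) * Sig N M d else 0) + (if d' = -d then -(1/4) * Sig N M d else 0)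
  + (1/2) * (M d' * M (d - d')) + (1/2) * (M d * M (d' - d))
  - (1/2) * (M d' * M (d + d')) - (1/2) * (M d * M (d' + d))

lemma sum_cos_zero (N : ℕ) (M : ℤ → ℝ) (hM1 : ∀ d : ℤ, M d + M (-d) = 0) (x : ℝ) :
    ∑ d ∈ Finset.Icc (-(N:ℤ)) N, M d * Real.cos (2*π*d*x) = 0 := by
  have h : ∑ d ∈ Finset.Icc (-(N:ℤ)) N, M d * Real.cos (2*π*d*x)
      = ∑ d ∈ Finset.Icc (-(N:ℤ)) N, M (-d) * Real.cos (2*π*d*x) := by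
    refine Finset.sum_nbij' (fun d => -d) (fun d => -d) ?_ ?_ ?_ ?_ ?_
    · intro a ha; simp only [Finset.mem_Icc] at *; omega
    · intro a ha; simp only [Finset.mem_Icc] at *; omega
    · intro a _; simp
    · intro a _; simp
    · intro a _
      rw [neg_neg]
      push_cast
      rw [show 2*π*(-(a:ℝ))*x = -(2*π*a*x) by ring, Real.cos_neg]
  have h2 : ∑ d ∈ Finset.Icc (-(N:ℤ)) N, M d * Real.cos (2*π*d*x)
      + ∑ d ∈ Finset.Icc (-(N:ℤ)) N, M (-d) * Real.cos (2*π*d*x) = 0 := by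
    rw [← Finset.sum_add_distrib]
    refine Finset.sum_eq_zero fun d _ => ?_
    rw [← add_mul, hM1, zero_mul]
  linarith

lemma Sig_eq (N : ℕ) (M : ℤ → ℝ) (h0 : M 0 = 0) (d : ℤ) :
    Sig N M d = ∑ d₁ ∈ Finset.Icc (-(N:ℤ)) N, ∑ d₂ ∈ Finset.Icc (-(N:ℤ)) N,
      if d₁ + d₂ = d then M d₁ * M d₂ else 0 := by
  unfold Sig
  refine Finset.sum_congr rfl fun a _ => Finset.sum_congr rfl fun b _ => ?_
  by_cases ha : a = 0
  · simp [ha, h0]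
  by_cases hb : b = 0
  · simp [hb, h0]
  simp [ha, hb]

lemma sum_Sig (N : ℕ) (M : ℤ → ℝ) (hM1 : ∀ d : ℤ, M d + M (-d) = 0) (x : ℝ) :
    ∑ d ∈ Finset.Icc (-(2*(N:ℤ))) (2*(N:ℤ)), Sig N M d * Real.cos (2*π*d*x)
      = - sFun N M x ^ 2 := by
  have h0 : M 0 = 0 := by have := hM1 0; simp at this; linarith
  simp only [Sig_eq N M h0, Finset.sum_mul]
  rw [Finset.sum_comm]
  have : ∀ a ∈ Finset.Icc (-(N:ℤ)) N,
      ∑ d ∈ Finset.Icc (-(2*(N:ℤ))) (2*(N:ℤ)), ∑ b ∈ Finset.Icc (-(N:ℤ)) N,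
        (if a + b = d then M a * M b else 0) * Real.cos (2*π*d*x)
      = ∑ b ∈ Finset.Icc (-(N:ℤ)) N,
        ((M a * Real.cos (2*π*a*x)) * (M b * Real.cos (2*π*b*x))
          - (M a * Real.sin (2*π*a*x)) * (M b * Real.sin (2*π*b*x))) := by
    intro a ha
    rw [Finset.sum_comm]
    refine Finset.sum_congr rfl fun b hb => ?_
    simp only [Finset.mem_Icc] at ha hb
    simp only [ite_mul, zero_mul]
    rw [Finset.sum_ite_eq, if_pos (by simp only [Finset.mem_Icc]; omega)]
    push_cast
    rw [show 2*π*((a:ℝ)+b)*x = 2*π*a*x + 2*π*b*x by ring, Real.cos_add]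
    ring
  rw [Finset.sum_congr rfl this]
  simp only [Finset.sum_sub_distrib, ← Finset.mul_sum, ← Finset.sum_mul]
  rw [sum_cos_zero N M hM1]
  unfold sFun
  ring

lemma shift_sum (N : ℕ) (M : ℤ → ℝ) (hM1 : ∀ d : ℤ, M d + M (-d) = 0)
    (hM3 : ∀ d : ℤ, (N:ℤ) < |d| → M d = 0) (m : ℤ) (hm : |m| ≤ (N:ℤ)) (x : ℝ) :
    ∑ d ∈ Finset.Icc (-(2*(N:ℤ))) (2*(N:ℤ)), M (d - m) * Real.cos (2*π*d*x)
      = - sFun N M x * Real.sin (2*π*m*x) := by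
  have h1 : ∑ d ∈ Finset.Icc (-(N:ℤ)) N, M d * Real.cos (2*π*((d + m : ℤ):ℝ)*x)
      = ∑ d ∈ Finset.Icc (-(2*(N:ℤ))) (2*(N:ℤ)), M (d - m) * Real.cos (2*π*d*x) := by
    rw [abs_le] at hm
    refine Finset.sum_of_injOn (fun d => d + m) ?_ ?_ ?_ ?_
    · intro a _ b _ h; simpa using h
    · intro a ha
      simp only [Finset.coe_Icc, Set.mem_Icc] at *
      omega
    · intro a ha hn
      rw [hM3, zero_mul]
      by_contra hc
      rw [not_lt, abs_le] at hc
      exact hn ⟨a - m, by simpa using hc, by simp⟩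
    · intro a _
      simp
  rw [← h1]
  have h2 : ∀ d ∈ Finset.Icc (-(N:ℤ)) N, M d * Real.cos (2*π*((d + m : ℤ):ℝ)*x)
      = (M d * Real.cos (2*π*d*x)) * Real.cos (2*π*m*x)
        - (M d * Real.sin (2*π*d*x)) * Real.sin (2*π*m*x) := by
    intro d _
    push_cast
    rw [show 2*π*((d:ℝ)+m)*x = 2*π*d*x + 2*π*m*x by ring, Real.cos_add]
    ring
  rw [Finset.sum_congr rfl h2, Finset.sum_sub_distrib, ← Finset.sum_mul, ← Finset.sum_mul,
    sum_cos_zero N M hM1]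
  unfold sFun
  ring

lemma conv_sum (N : ℕ) (M : ℤ → ℝ) (hM1 : ∀ d : ℤ, M d + M (-d) = 0)
    (hM3 : ∀ d : ℤ, (N:ℤ) < |d| → M d = 0) (x y : ℝ) :
    ∑ d' ∈ Finset.Icc (-(2*(N:ℤ))) (2*(N:ℤ)), ∑ d ∈ Finset.Icc (-(2*(N:ℤ))) (2*(N:ℤ)),
      (M d' * M (d - d')) * Real.cos (2*π*d*x) * Real.cos (2*π*d'*y)
      = - sFun N M x * qFun N M x y := by
  unfold qFun
  rw [Finset.mul_sum]
  symm
  refine Finset.sum_subset_zero_on_sdiff ?_ ?_ ?_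
  · intro a ha; simp only [Finset.mem_Icc] at *; omega
  · intro a ha
    simp only [Finset.mem_sdiff, Finset.mem_Icc] at ha
    refine Finset.sum_eq_zero fun d _ => ?_
    rw [hM3 a (by by_contra hc; rw [not_lt, abs_le] at hc; omega)]
    ring
  · intro a ha
    rw [Finset.mem_Icc, ← abs_le] at ha
    have := shift_sum N M hM1 hM3 a ha x
    calc _ = M a * Real.cos (2*π*a*y) * (- sFun N M x * Real.sin (2*π*a*x)) := by ring
      _ = _ := by
        rw [← this, Finset.mul_sum]
        exact Finset.sum_congr rfl fun d _ => by ring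

lemma conv_sum' (N : ℕ) (M : ℤ → ℝ) (hM1 : ∀ d : ℤ, M d + M (-d) = 0)
    (hM3 : ∀ d : ℤ, (N:ℤ) < |d| → M d = 0) (x y : ℝ) :
    ∑ d' ∈ Finset.Icc (-(2*(N:ℤ))) (2*(N:ℤ)), ∑ d ∈ Finset.Icc (-(2*(N:ℤ))) (2*(N:ℤ)),
      (M d' * M (d + d')) * Real.cos (2*π*d*x) * Real.cos (2*π*d'*y)
      = sFun N M x * qFun N M x y := by
  have h := conv_sum N M hM1 hM3 x y
  have h2 : ∑ d' ∈ Finset.Icc (-(2*(N:ℤ))) (2*(N:ℤ)), ∑ d ∈ Finset.Icc (-(2*(N:ℤ))) (2*(N:ℤ)),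
      (M d' * M (d + d')) * Real.cos (2*π*d*x) * Real.cos (2*π*d'*y)
      = ∑ d' ∈ Finset.Icc (-(2*(N:ℤ))) (2*(N:ℤ)), -∑ d ∈ Finset.Icc (-(2*(N:ℤ))) (2*(N:ℤ)),
      (M d' * M (d - d')) * Real.cos (2*π*d*x) * Real.cos (2*π*d'*y) := by
    refine Finset.sum_nbij' (fun d => -d) (fun d => -d) ?_ ?_ ?_ ?_ ?_
    · intro a ha; simp only [Finset.mem_Icc] at *; omega
    · intro a ha; simp only [Finset.mem_Icc] at *; omega
    · intro a _; simp
    · intro a _; simp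
    · intro a _
      rw [← Finset.sum_neg_distrib]
      refine Finset.sum_congr rfl fun d _ => ?_
      have h3 : M (-a) = - M a := by linarith [hM1 a]
      rw [h3]
      push_cast
      rw [show 2*π*(-(a:ℝ))*y = -(2*π*a*y) by ring, Real.cos_neg, sub_neg_eq_add]
      ring
  rw [h2, Finset.sum_neg_distrib, h]
  ring

lemma Sig_zero (N : ℕ) (M : ℤ → ℝ) (hM1 : ∀ d : ℤ, M d + M (-d) = 0) :
    Sig N M 0 = -2 * ∑ j ∈ Finset.Icc (1:ℤ) N, M j ^ 2 := by
  have h0 : M 0 = 0 := by have := hM1 0; simp at this; linarith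
  have hneg : ∀ d, M (-d) = - M d := fun d => by linarith [hM1 d]
  rw [Sig_eq N M h0]
  have h1 : ∀ a ∈ Finset.Icc (-(N:ℤ)) N, (∑ b ∈ Finset.Icc (-(N:ℤ)) N,
      if a + b = 0 then M a * M b else 0) = - M a ^ 2 := by
    intro a ha
    simp only [Finset.mem_Icc] at ha
    rw [Finset.sum_eq_single (-a)]
    · simp [hneg]; ring
    · intro b _ hb; rw [if_neg]; omega
    · intro h; exfalso; apply h; simp only [Finset.mem_Icc]; omega
  rw [Finset.sum_congr rfl h1]
  have hs : Finset.Icc (-(N:ℤ)) N = (Finset.Icc (-(N:ℤ)) (-1) ∪ {0}) ∪ Finset.Icc 1 (N:ℤ) := by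
    ext a; simp only [Finset.mem_Icc, Finset.mem_union, Finset.mem_singleton]; omega
  rw [hs, Finset.sum_union, Finset.sum_union, Finset.sum_singleton, h0]
  · have : ∑ a ∈ Finset.Icc (-(N:ℤ)) (-1), -M a ^ 2 = ∑ a ∈ Finset.Icc 1 (N:ℤ), - M a ^ 2 := by
      refine Finset.sum_nbij' (fun d => -d) (fun d => -d) ?_ ?_ ?_ ?_ ?_
      · intro a ha; simp only [Finset.mem_Icc] at *; omega
      · intro a ha; simp only [Finset.mem_Icc] at *; omega
      · intro a _; simp
      · intro a _; simp
      · intro a _; simp [hneg]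
    rw [this, Finset.sum_neg_distrib]
    ring
  · rw [Finset.disjoint_left]; intro a; simp only [Finset.mem_Icc, Finset.mem_singleton]; omega
  · rw [Finset.disjoint_left]; intro a
    simp only [Finset.mem_Icc, Finset.mem_singleton, Finset.mem_union]; omega

lemma Kcoef_eq (N : ℕ) (M : ℤ → ℝ)
    (hM1 : ∀ d : ℤ, M d + M (-d) = 0)
    (hM2 : ∀ d : ℤ, (2*|d| ≤ (N:ℤ) ∨ (N:ℤ) < |d|) → M d = 0)
    (d d' : ℤ) (hd : |d| ≤ 2*(N:ℤ)) (hd' : |d'| ≤ 2*(N:ℤ)) :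
    Kcoef N M d d' = Tcoef N M d d' := by
  have h0 : M 0 = 0 := by have := hM1 0; simp at this; linarith
  have hneg : ∀ d, M (-d) = - M d := fun d => by linarith [hM1 d]
  have hM3 : ∀ d : ℤ, (N:ℤ) < |d| → M d = 0 := fun d h => hM2 d (Or.inr h)
  have hsub : M (d' - d) = - M (d - d') := by rw [← hneg]; congr 1; ring
  have hadd : M (d' + d) = M (d + d') := by congr 1; ring
  have hS := Sig_zero N M hM1
  by_cases e0 : d = 0
  · subst e0
    by_cases e1 : d' = 0
    · subst e1
      simp [Kcoef, Tcoef, h0, hS]; ring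
    · have a1 : 1 ≤ |d'| := Int.one_le_abs e1
      by_cases e2 : |d'| ≤ (N:ℤ)
      · simp [Kcoef, Tcoef, h0, e1, a1, e2, hneg]; ring
      · have a3 := hM3 d' (by omega)
        simp [Kcoef, Tcoef, h0, e1, a1, e2, hneg, a3]; intros; omega
  by_cases e1 : d' = 0
  · subst e1
    have a1 : 1 ≤ |d| := Int.one_le_abs e0
    have e5 : ¬ (0 = d) := fun h => e0 h.symm
    by_cases e2 : |d| ≤ (N:ℤ)
    · simp [Kcoef, Tcoef, h0, e0, e5, a1, e2, hneg]; ring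
    · have a3 := hM3 d (by omega)
      simp [Kcoef, Tcoef, h0, e0, e5, a1, e2, hneg, a3]; intros; omega
  have a1 : 1 ≤ |d| := Int.one_le_abs e0
  have a1' : 1 ≤ |d'| := Int.one_le_abs e1
  by_cases e3 : d' = d ∨ d' = -d
  · have hK : Kcoef N M d d' = -(1/4) * Sig N M d - M d * M (2*d) := by
      simp only [Kcoef, e0, e1, e3, a1, hd]
      simp only [false_and, and_false, if_false, true_and, if_true, and_self]
      split_ifs with h
      · rfl
      · rw [hM3 (2*d) (by rw [abs_mul]; simp; omega)]; ring
    rw [hK]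
    rcases e3 with e3 | e3
    · subst e3
      have : ¬ (d' = -d') := by omega
      simp [Tcoef, e0, this, h0, ← two_mul]
      ring
    · subst e3
      have : ¬ (-d = d) := by omega
      simp [Tcoef, e0, this, h0, ← two_mul, hneg]
      have : M (-d - d) = - M (2*d) := by rw [← hneg]; congr 1; ring
      rw [this]; ring
  push Not at e3
  obtain ⟨e3, e4⟩ := e3
  have hT : Tcoef N M d d' = (1/2) * (M d' * M (d - d') + M d * M (d' - d)
        - M d' * M (d + d') - M d * M (d + d')) := by
    simp only [Tcoef, e0, e1, e3, e4, if_false, hadd]; ring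
  rw [hT]
  have hab : |d| = d ∨ |d| = -d := abs_choice d
  have hab' : |d'| = d' ∨ |d'| = -d' := abs_choice d'
  have b1 := le_abs_self (d - d')
  have b2 := neg_le_abs (d - d')
  have b3 := le_abs_self (d + d')
  have b4 := neg_le_abs (d + d')
  simp only [Kcoef, e0, e1, e3, e4, or_self, false_and, and_false, if_false, a1, a1', hd, hd',
    true_and, and_true]
  have z1 := hM3 d
  have z2 := hM3 d'
  have z3 := hM3 (d - d')
  have z4 := hM3 (d + d')
  rw [abs_sub_comm d' d, hsub, add_comm d' d]
  by_cases c1 : |d| ≤ (N:ℤ) <;> by_cases c2 : |d'| ≤ (N:ℤ) <;>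
    by_cases c3 : |d - d'| ≤ (N:ℤ) <;> by_cases c4 : |d + d'| ≤ (N:ℤ)
  all_goals
    simp only [c1, c2, c3, c4, not_lt.mpr, lt_of_not_ge, if_true, if_false, and_true, true_and,
      and_false, false_and, and_self, not_true, not_false_iff]
  all_goals first
    | (simp only [not_le] at *; simp only [z1, z2, z3, z4, *]; ring1)
    | (exfalso; omega)

lemma Khat_eq (N : ℕ) (M : ℤ → ℝ)
    (hM1 : ∀ d : ℤ, M d + M (-d) = 0)
    (hM2 : ∀ d : ℤ, (2*|d| ≤ (N:ℤ) ∨ (N:ℤ) < |d|) → M d = 0) (k y : ℝ) :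
    Khat N M k y = (1/4) * ((sFun N M k + sFun N M y - sFun N M (k + y)) ^ 2
      + (sFun N M k + sFun N M (-y) - sFun N M (k + -y)) ^ 2) := by
  have hM3 : ∀ d : ℤ, (N:ℤ) < |d| → M d = 0 := fun d h => hM2 d (Or.inr h)
  have hp : sFun N M (k + y) = qFun N M k y + qFun N M y k := by
    unfold sFun qFun
    rw [← Finset.sum_add_distrib]
    refine Finset.sum_congr rfl fun d _ => ?_
    rw [show 2*π*d*(k+y) = 2*π*d*k + 2*π*d*y by ring, Real.sin_add]; ring
  have hm : sFun N M (k + -y) = qFun N M k y - qFun N M y k := by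
    unfold sFun qFun
    rw [← Finset.sum_sub_distrib]
    refine Finset.sum_congr rfl fun d _ => ?_
    rw [show 2*π*d*(k+-y) = 2*π*d*k - 2*π*d*y by ring, Real.sin_sub]; ring
  have hn : sFun N M (-y) = - sFun N M y := by
    unfold sFun
    rw [← Finset.sum_neg_distrib]
    refine Finset.sum_congr rfl fun d _ => ?_
    rw [show 2*π*d*(-y) = -(2*π*d*y) by ring, Real.sin_neg]; ring
  have hdiag : ∑ d ∈ Finset.Icc (-(2*(N:ℤ))) (2*(N:ℤ)),
      Sig N M d * Real.cos (2*π*d*k) * Real.cos (2*π*d*y)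
      = -(1/2) * (sFun N M (k + y) ^ 2 + sFun N M (k + -y) ^ 2) := by
    have e1 := sum_Sig N M hM1 (k + y)
    have e2 := sum_Sig N M hM1 (k + -y)
    have : ∑ d ∈ Finset.Icc (-(2*(N:ℤ))) (2*(N:ℤ)),
      Sig N M d * Real.cos (2*π*d*k) * Real.cos (2*π*d*y)
      = (1/2) * (∑ d ∈ Finset.Icc (-(2*(N:ℤ))) (2*(N:ℤ)), Sig N M d * Real.cos (2*π*d*(k+y))
       + ∑ d ∈ Finset.Icc (-(2*(N:ℤ))) (2*(N:ℤ)), Sig N M d * Real.cos (2*π*d*(k+-y))) := by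
      rw [← Finset.sum_add_distrib, Finset.mul_sum]
      refine Finset.sum_congr rfl fun d _ => ?_
      rw [show 2*π*d*(k+-y) = 2*π*d*k - 2*π*d*y by ring, Real.cos_sub,
        show 2*π*d*(k+y) = 2*π*d*k + 2*π*d*y by ring, Real.cos_add]; ring
    rw [this, e1, e2]; ring
  have c1 := conv_sum N M hM1 hM3 k y
  have c2 := conv_sum N M hM1 hM3 y k
  have c3 := conv_sum' N M hM1 hM3 k y
  have c4 := conv_sum' N M hM1 hM3 y k
  rw [Finset.sum_comm] at c1 c3
  have hz : (0:ℤ) ∈ Finset.Icc (-(2*(N:ℤ))) (2*(N:ℤ)) := by simp only [Finset.mem_Icc]; omega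
  have t1 : ∑ d ∈ Finset.Icc (-(2*(N:ℤ))) (2*(N:ℤ)), ∑ d' ∈ Finset.Icc (-(2*(N:ℤ))) (2*(N:ℤ)),
      (if d' = 0 then -(1/2) * Sig N M d else 0) * Real.cos (2*π*d*k) * Real.cos (2*π*d'*y)
      = (1/2) * sFun N M k ^ 2 := by
    rw [show (1/2) * sFun N M k ^ 2 = -(1/2) * (- sFun N M k ^ 2) by ring, ← sum_Sig N M hM1,
      Finset.mul_sum]
    refine Finset.sum_congr rfl fun d _ => ?_
    simp only [ite_mul, zero_mul]
    rw [Finset.sum_ite_eq', if_pos hz]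
    simp; ring
  have t2 : ∑ d ∈ Finset.Icc (-(2*(N:ℤ))) (2*(N:ℤ)), ∑ d' ∈ Finset.Icc (-(2*(N:ℤ))) (2*(N:ℤ)),
      (if d = 0 then -(1/2) * Sig N M d' else 0) * Real.cos (2*π*d*k) * Real.cos (2*π*d'*y)
      = (1/2) * sFun N M y ^ 2 := by
    rw [show (1/2) * sFun N M y ^ 2 = -(1/2) * (- sFun N M y ^ 2) by ring, ← sum_Sig N M hM1,
      Finset.mul_sum, Finset.sum_comm]
    refine Finset.sum_congr rfl fun d _ => ?_
    simp only [ite_mul, zero_mul]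
    rw [Finset.sum_ite_eq', if_pos hz]
    simp; ring
  have t3 : ∑ d ∈ Finset.Icc (-(2*(N:ℤ))) (2*(N:ℤ)), ∑ d' ∈ Finset.Icc (-(2*(N:ℤ))) (2*(N:ℤ)),
      (if d' = d then -(1/4) * Sig N M d else 0) * Real.cos (2*π*d*k) * Real.cos (2*π*d'*y)
      = (1/8) * (sFun N M (k + y) ^ 2 + sFun N M (k + -y) ^ 2) := by
    rw [show (1/8) * (sFun N M (k + y) ^ 2 + sFun N M (k + -y) ^ 2) = -(1/4) *
      (-(1/2) * (sFun N M (k + y) ^ 2 + sFun N M (k + -y) ^ 2)) by ring, ← hdiag, Finset.mul_sum]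
    refine Finset.sum_congr rfl fun d hd => ?_
    simp only [ite_mul, zero_mul]
    rw [Finset.sum_ite_eq', if_pos hd]
    ring
  have t4 : ∑ d ∈ Finset.Icc (-(2*(N:ℤ))) (2*(N:ℤ)), ∑ d' ∈ Finset.Icc (-(2*(N:ℤ))) (2*(N:ℤ)),
      (if d' = -d then -(1/4) * Sig N M d else 0) * Real.cos (2*π*d*k) * Real.cos (2*π*d'*y)
      = (1/8) * (sFun N M (k + y) ^ 2 + sFun N M (k + -y) ^ 2) := by
    rw [show (1/8) * (sFun N M (k + y) ^ 2 + sFun N M (k + -y) ^ 2) = -(1/4) *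
      (-(1/2) * (sFun N M (k + y) ^ 2 + sFun N M (k + -y) ^ 2)) by ring, ← hdiag, Finset.mul_sum]
    refine Finset.sum_congr rfl fun d hd => ?_
    simp only [ite_mul, zero_mul]
    rw [Finset.sum_ite_eq', if_pos (by simp only [Finset.mem_Icc] at *; omega)]
    push_cast
    rw [show 2*π*(-(d:ℝ))*y = -(2*π*d*y) by ring, Real.cos_neg]
    ring
  have hK : Khat N M k y = ∑ d ∈ Finset.Icc (-(2*(N:ℤ))) (2*(N:ℤ)),
      ∑ d' ∈ Finset.Icc (-(2*(N:ℤ))) (2*(N:ℤ)),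
      ((if d' = 0 then -(1/2) * Sig N M d else 0) * Real.cos (2*π*d*k) * Real.cos (2*π*d'*y)
      + (if d = 0 then -(1/2) * Sig N M d' else 0) * Real.cos (2*π*d*k) * Real.cos (2*π*d'*y)
      + (if d' = d then -(1/4) * Sig N M d else 0) * Real.cos (2*π*d*k) * Real.cos (2*π*d'*y)
      + (if d' = -d then -(1/4) * Sig N M d else 0) * Real.cos (2*π*d*k) * Real.cos (2*π*d'*y)
      + (1/2) * ((M d' * M (d - d')) * Real.cos (2*π*d*k) * Real.cos (2*π*d'*y))
      + (1/2) * ((M d * M (d' - d)) * Real.cos (2*π*d'*y) * Real.cos (2*π*d*k))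
      - (1/2) * ((M d' * M (d + d')) * Real.cos (2*π*d*k) * Real.cos (2*π*d'*y))
      - (1/2) * ((M d * M (d' + d)) * Real.cos (2*π*d'*y) * Real.cos (2*π*d*k))) := by
    unfold Khat
    refine Finset.sum_congr rfl fun d hd => Finset.sum_congr rfl fun d' hd' => ?_
    rw [Finset.mem_Icc, ← abs_le] at hd hd'
    rw [Kcoef_eq N M hM1 hM2 d d' hd hd']
    unfold Tcoef
    ring
  rw [hK]
  simp only [Finset.sum_add_distrib, Finset.sum_sub_distrib, ← Finset.mul_sum]
  rw [t1, t2, t3, t4, c1, c2, c3, c4, hn, hp, hm]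
  ring

/-- the character `e^{-2πiyn}` -/
lemma integral_char (m : ℤ) :
    ∫ y in (-(1/2) : ℝ)..(1/2), Complex.exp (-(2*(π:ℂ)*Complex.I) * y * m)
      = if m = 0 then 1 else 0 := by
  split_ifs with h
  · subst h; simp; norm_num
  · have hc : -(2*(π:ℂ)*Complex.I) * m ≠ 0 := by
      have : (m:ℂ) ≠ 0 := by exact_mod_cast h
      have hp : (π:ℂ) ≠ 0 := by exact_mod_cast Real.pi_ne_zero
      simp [this, hp]
    have e : ∀ y : ℝ, Complex.exp (-(2*(π:ℂ)*Complex.I) * y * m)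
      = Complex.exp ((-(2*(π:ℂ)*Complex.I) * m) * y) := fun y => by congr 1; ring
    simp only [e]
    rw [integral_exp_mul_complex hc]
    have : Complex.exp (-(2*(π:ℂ)*Complex.I) * m * ((1/2 : ℝ):ℂ))
        = Complex.exp (-(2*(π:ℂ)*Complex.I) * m * ((-(1/2) : ℝ):ℂ)) := by
      rw [Complex.exp_eq_exp_iff_exists_int]
      exact ⟨-m, by push_cast; ring⟩
    rw [this, sub_self, zero_div]

lemma parseval (F : Finset ℤ) (b : ℤ → ℂ) :
    ∫ y in (-(1/2) : ℝ)..(1/2),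
        ‖∑ n ∈ F, b n * Complex.exp (-(2*(π:ℂ)*Complex.I) * y * n)‖ ^ 2
      = ∑ n ∈ F, ‖b n‖ ^ 2 := by
  apply Complex.ofReal_injective
  rw [← intervalIntegral.integral_ofReal]
  have e : ∀ y : ℝ, ((‖∑ n ∈ F, b n * Complex.exp (-(2*(π:ℂ)*Complex.I) * y * n)‖ ^ 2 : ℝ) : ℂ)
      = ∑ m ∈ F, ∑ n ∈ F, (b m * (starRingEnd ℂ) (b n)) *
        Complex.exp (-(2*(π:ℂ)*Complex.I) * y * ((m - n : ℤ):ℂ)) := by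
    intro y
    rw [Complex.ofReal_pow, ← Complex.mul_conj', map_sum, Finset.sum_mul_sum]
    refine Finset.sum_congr rfl fun m _ => Finset.sum_congr rfl fun n _ => ?_
    rw [map_mul, ← Complex.exp_conj]
    have : (starRingEnd ℂ) (-(2*(π:ℂ)*Complex.I) * y * n) = (2*(π:ℂ)*Complex.I) * y * n := by
      simp [Complex.conj_ofNat]
    push_cast
    rw [this, show -(2*(π:ℂ)*Complex.I) * y * ((m:ℂ) - n)
      = -(2*(π:ℂ)*Complex.I) * y * m + (2*(π:ℂ)*Complex.I) * y * n by ring, Complex.exp_add]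
    ring
  simp only [e]
  rw [intervalIntegral.integral_finsetSum]
  · rw [Complex.ofReal_sum]
    refine Finset.sum_congr rfl fun m hm => ?_
    rw [intervalIntegral.integral_finsetSum]
    · rw [Finset.sum_eq_single m]
      · rw [intervalIntegral.integral_const_mul, integral_char]
        simp [Complex.mul_conj']
      · intro n _ hn
        rw [intervalIntegral.integral_const_mul, integral_char, if_neg (by omega), mul_zero]
      · intro h; exact absurd hm h
    · intro n _
      exact Continuous.intervalIntegrable (by fun_prop) _ _
  · intro m _
    exact Continuous.intervalIntegrable (by fun_prop) _ _

/-- `c_n` up to a phase -/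
noncomputable def bFun (N : ℕ) (M : ℤ → ℝ) (α : ℤ → ℝ) (k : ℝ) (n : ℤ) : ℂ :=
  ∑ d ∈ Finset.Icc (-(N:ℤ)) (N:ℤ), (M d : ℂ) * (((α n : ℂ) - α (n+d)) *
    Complex.exp ((2*(π:ℂ)*Complex.I) * k * d) + α (n+d))

lemma norm_cFun (N : ℕ) (M : ℤ → ℝ) (h0 : M 0 = 0) (α : ℤ → ℝ) (k : ℝ) (n : ℤ) :
    ‖cFun N M α k n‖ = ‖bFun N M α k n‖ := by
  have h : cFun N M α k n = Complex.exp (-(2*(π:ℂ)*Complex.I) * k * (n:ℂ)) * bFun N M α k n := by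
    unfold cFun bFun
    rw [Finset.sum_erase _ (by simp [h0]), Finset.sum_erase _ (by simp [h0]), Finset.mul_sum]
    push_cast
    rw [Finset.sum_mul, ← Finset.sum_add_distrib]
    refine Finset.sum_congr rfl fun d _ => ?_
    rw [show -(2*(π:ℂ)*Complex.I) * k * ((n:ℂ) - d)
      = -(2*(π:ℂ)*Complex.I) * k * n + (2*(π:ℂ)*Complex.I) * k * d by ring, Complex.exp_add]
    ring
  rw [h, norm_mul]
  have : ‖Complex.exp (-(2*(π:ℂ)*Complex.I) * k * (n:ℂ))‖ = 1 := by
    rw [Complex.norm_exp]; simp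
  rw [this, one_mul]

lemma sum_exp (N : ℕ) (M : ℤ → ℝ) (hM1 : ∀ d : ℤ, M d + M (-d) = 0) (x : ℝ) :
    ∑ d ∈ Finset.Icc (-(N:ℤ)) (N:ℤ), (M d : ℂ) * Complex.exp ((2*(π:ℂ)*Complex.I) * x * d)
      = Complex.I * (sFun N M x : ℂ) := by
  have h := sum_cos_zero N M hM1 x
  have h' := congrArg (fun r : ℝ => (r : ℂ)) h
  rw [← zero_add (Complex.I * _), ← Complex.ofReal_zero, ← h']
  unfold sFun
  push_cast
  rw [Finset.mul_sum, ← Finset.sum_add_distrib]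
  refine Finset.sum_congr rfl fun d _ => ?_
  rw [show (2*(π:ℂ)*Complex.I) * x * d = (2*(π:ℂ)*d*x) * Complex.I by ring, Complex.exp_mul_I]
  ring

lemma hasSum_cast {f g : ℤ → ℂ} {a b : ℂ} (h : HasSum f a) (hf : ∀ n, g n = f n)
    (hab : b = a) : HasSum g b := by
  rw [hab, funext hf]
  exact h

lemma hasSum_bFun (N : ℕ) (M : ℤ → ℝ) (hM1 : ∀ d : ℤ, M d + M (-d) = 0)
    (α : ℤ → ℝ) (hα : (Function.support α).Finite) (k y : ℝ) :
    HasSum (fun n : ℤ => bFun N M α k n * Complex.exp (-(2*(π:ℂ)*Complex.I) * y * n))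
      (Complex.I * ((sFun N M k + sFun N M y - sFun N M (k + y) : ℝ) : ℂ) * alphaHat α y) := by
  have hA : HasSum (fun n : ℤ => (α n : ℂ) * Complex.exp (-(2*(π:ℂ)*Complex.I) * y * n))
      (alphaHat α y) := by
    refine Summable.hasSum (summable_of_hasFiniteSupport ?_)
    refine hα.subset fun n hn => ?_
    intro h; apply hn; simp [h]
  have hd : ∀ d : ℤ, HasSum (fun n : ℤ => (α (n + d) : ℂ) *
      Complex.exp (-(2*(π:ℂ)*Complex.I) * y * n))
      (Complex.exp ((2*(π:ℂ)*Complex.I) * y * d) * alphaHat α y) := by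
    intro d
    have h1 := ((Equiv.addRight d).hasSum_iff.mpr hA).mul_left
      (Complex.exp ((2*(π:ℂ)*Complex.I) * y * d))
    refine hasSum_cast h1 (fun n => ?_) rfl
    simp only [Function.comp, Equiv.coe_addRight]
    push_cast
    rw [show -(2*(π:ℂ)*Complex.I) * y * n = (2*(π:ℂ)*Complex.I) * y * d
      + -(2*(π:ℂ)*Complex.I) * y * (n + d) by ring, Complex.exp_add]
    ring
  have hs := hasSum_sum (s := Finset.Icc (-(N:ℤ)) (N:ℤ)) fun d _ =>
    ((((hA.sub (hd d)).mul_left (Complex.exp ((2*(π:ℂ)*Complex.I) * k * d))).add (hd d)).mul_left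
      (M d : ℂ))
  refine hasSum_cast hs (fun n => ?_) ?_
  · unfold bFun
    rw [Finset.sum_mul]
    refine Finset.sum_congr rfl fun d _ => ?_
    ring
  · push_cast
    rw [mul_sub, mul_add, ← sum_exp N M hM1, ← sum_exp N M hM1, ← sum_exp N M hM1,
      ← Finset.sum_add_distrib, ← Finset.sum_sub_distrib, Finset.sum_mul]
    refine Finset.sum_congr rfl fun d _ => ?_
    push_cast
    rw [show (2*(π:ℂ)*Complex.I) * (k + y) * d = (2*(π:ℂ)*Complex.I) * k * d
      + (2*(π:ℂ)*Complex.I) * y * d by ring, Complex.exp_add]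
    ring

lemma finite_bFun (N : ℕ) (M : ℤ → ℝ)
    (α : ℤ → ℝ) (hα : (Function.support α).Finite) (k : ℝ) :
    (Function.support (bFun N M α k)).Finite := by
  have hf : (⋃ d ∈ (Finset.Icc (-(N:ℤ)) (N:ℤ) : Finset ℤ),
      (fun n : ℤ => n + d) ⁻¹' (Function.support α)).Finite := by
    refine Set.Finite.biUnion (Finset.finite_toSet _) fun d _ => ?_
    exact hα.preimage (fun a _ b _ h => by simpa using h)
  refine hf.subset fun n hn => ?_
  by_contra hc
  simp only [Set.mem_iUnion, Set.mem_preimage, Function.mem_support, not_exists, not_not] at hc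
  apply hn
  unfold bFun
  refine Finset.sum_eq_zero fun d hd => ?_
  have h1 := hc d hd
  have h2 := hc 0 (by simp)
  rw [add_zero] at h2
  simp [h1, h2]

lemma norm_alphaHat_neg (α : ℤ → ℝ) (y : ℝ) : ‖alphaHat α (-y)‖ = ‖alphaHat α y‖ := by
  have : alphaHat α (-y) = (starRingEnd ℂ) (alphaHat α y) := by
    unfold alphaHat
    rw [Complex.conj_tsum]
    refine tsum_congr fun n => ?_
    rw [map_mul, ← Complex.exp_conj]
    simp [Complex.conj_ofNat]
  rw [this, Complex.norm_conj]

lemma continuous_alphaHat (α : ℤ → ℝ) (hα : (Function.support α).Finite) :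
    Continuous (alphaHat α) := by
  have : alphaHat α = fun y : ℝ => ∑ n ∈ hα.toFinset,
      (α n : ℂ) * Complex.exp (-(2*(π:ℂ)*Complex.I) * y * n) := by
    funext y
    refine tsum_eq_sum fun n hn => ?_
    simp at hn
    simp [hn]
  rw [this]
  fun_prop

lemma continuous_sFun (N : ℕ) (M : ℤ → ℝ) : Continuous (sFun N M) := by
  unfold sFun
  fun_prop

/-- **Kernel representation of the quadratic variation:** for finitely supported `α` and
every `k ∈ ℝ`, `(1/2) ∑_{n∈ℤ} |c_n(k)|² = ∫_{−1/2}^{1/2} K̂_M(k,k') |α̂(k')|² dk'`. -/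
theorem quadratic_variation_kernel_repr (N : ℕ) (hN : 1 ≤ N) (M : ℤ → ℝ)
    (hM1 : ∀ d : ℤ, M d + M (-d) = 0)
    (hM2 : ∀ d : ℤ, (2*|d| ≤ (N:ℤ) ∨ (N:ℤ) < |d|) → M d = 0)
    (α : ℤ → ℝ) (hα : (Function.support α).Finite) (k : ℝ) :
    (1/2) * ∑' n : ℤ, ‖cFun N M α k n‖ ^ 2
      = ∫ k' in (-(1/2) : ℝ)..(1/2), Khat N M k k' * ‖alphaHat α k'‖ ^ 2 := by
  have h0 : M 0 = 0 := by have := hM1 0; simp at this; linarith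
  have hfin := finite_bFun N M α hα k
  have hL : ∑' n : ℤ, ‖cFun N M α k n‖ ^ 2 = ∑ n ∈ hfin.toFinset, ‖bFun N M α k n‖ ^ 2 := by
    simp only [norm_cFun N M h0]
    refine tsum_eq_sum fun n hn => ?_
    simp at hn
    simp [hn]
  have hB : ∀ y : ℝ, ‖∑ n ∈ hfin.toFinset, bFun N M α k n *
      Complex.exp (-(2*(π:ℂ)*Complex.I) * y * n)‖ ^ 2
      = (sFun N M k + sFun N M y - sFun N M (k + y)) ^ 2 * ‖alphaHat α y‖ ^ 2 := by
    intro y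
    have h1 := (hasSum_bFun N M hM1 α hα k y).tsum_eq
    rw [tsum_eq_sum (s := hfin.toFinset)] at h1
    · rw [h1, norm_mul, norm_mul, Complex.norm_I, Complex.norm_real, mul_pow, one_mul,
        Real.norm_eq_abs, sq_abs]
    · intro n hn
      simp at hn
      simp [hn]
  rw [hL, ← parseval]
  simp only [hB]
  have hca := continuous_alphaHat α hα
  have hcs := continuous_sFun N M
  set f : ℝ → ℝ := fun y => (sFun N M k + sFun N M y - sFun N M (k + y)) ^ 2 * ‖alphaHat α y‖ ^ 2
    with hf
  have hcf : Continuous f := by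
    rw [hf]
    fun_prop
  have hrefl : ∫ y in (-(1/2) : ℝ)..(1/2), f (-y) = ∫ y in (-(1/2) : ℝ)..(1/2), f y := by
    rw [intervalIntegral.integral_comp_neg]
    simp
  have hR : ∀ y : ℝ, Khat N M k y * ‖alphaHat α y‖ ^ 2 = (1/4) * (f y + f (-y)) := by
    intro y
    rw [Khat_eq N M hM1 hM2, hf]
    simp only [norm_alphaHat_neg]
    ring
  simp only [hR]
  rw [intervalIntegral.integral_const_mul, intervalIntegral.integral_add, hrefl]
  · ring
  · exact hcf.intervalIntegrable _ _
  · exact (hcf.comp continuous_neg).intervalIntegrable _ _
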